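/- 𝒞_2(6,6,3) = 9; that is, the maximum cardinality of a cyclic code C ⊆ G_2(6,3) with minimum subspace distance at least 6 equals 9. -/

import Mathlib

open Module

/-- The cyclic shift `αV = {αv : v ∈ V}` of an `Fq`-subspace `V` of the extension field `F`
by a field element `α`. -/
def cyclicShift (Fq F : Type*) [Field Fq] [Field F] [Algebra Fq F]
    (α : F) (V : Submodule Fq F) : Submodule Fq F :=
  Submodule.map (LinearMap.mulLeft Fq α) V

/-- The subspace distance `d(U,W) = dim U + dim W − 2 dim (U ∩ W)`. -/
noncomputable def subspaceDist (Fq F : Type*) [Field Fq] [Field F] [Algebra Fq F]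
    (U W : Submodule Fq F) : ℕ :=
  finrank Fq U + finrank Fq W - 2 * finrank Fq ↥(U ⊓ W)

/-- `C` is a cyclic code in the Grassmannian `G_q(n,k)` (all members have dimension `k`,
and `C` is closed under cyclic shifts by nonzero field elements) with minimum subspace
distance at least `d`. -/
def IsCyclicCode (Fq F : Type*) [Field Fq] [Field F] [Algebra Fq F]
    (k d : ℕ) (C : Set (Submodule Fq F)) : Prop :=
  (∀ U ∈ C, finrank Fq U = k) ∧
  (∀ α : F, α ≠ 0 → ∀ U ∈ C, cyclicShift Fq F α U ∈ C) ∧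
  (∀ U ∈ C, ∀ W ∈ C, U ≠ W → d ≤ subspaceDist Fq F U W)

/-- The orbit `orb(V) = {αV : α ∈ F, α ≠ 0}` of a subspace `V`. -/
def orbitOf (Fq F : Type*) [Field Fq] [Field F] [Algebra Fq F]
    (V : Submodule Fq F) : Set (Submodule Fq F) :=
  {W | ∃ α : F, α ≠ 0 ∧ W = cyclicShift Fq F α V}

/-- The set of orbits of members of a code `C`. -/
def orbitsOf (Fq F : Type*) [Field Fq] [Field F] [Algebra Fq F]
    (C : Set (Submodule Fq F)) : Set (Set (Submodule Fq F)) :=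
  {O | ∃ V ∈ C, O = orbitOf Fq F V}

section

variable {F : Type*} [Field F] [Algebra (ZMod 2) F]

theorem mem_cyclicShift {V : Submodule (ZMod 2) F} {a x : F} :
    x ∈ cyclicShift (ZMod 2) F a V ↔ ∃ v ∈ V, a * v = x := by
  simp [cyclicShift]

theorem cyclicShift_cyclicShift (a b : F) (V : Submodule (ZMod 2) F) :
    cyclicShift (ZMod 2) F a (cyclicShift (ZMod 2) F b V) =
      cyclicShift (ZMod 2) F (a * b) V := by
  ext x
  simp [mem_cyclicShift, mul_assoc]

theorem finrank_cyclicShift {a : F} (ha : a ≠ 0) (V : Submodule (ZMod 2) F) :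
    finrank (ZMod 2) (cyclicShift (ZMod 2) F a V) = finrank (ZMod 2) V :=
  (Submodule.equivMapOfInjective _ (mul_right_injective₀ ha) V).finrank_eq.symm

/-- The fixed points of the third power of the Frobenius map, as a subspace. -/
def frobeniusCubeFixed (F : Type*) [Field F] [Algebra (ZMod 2) F] :
    Submodule (ZMod 2) F where
  carrier := {x | x ^ 8 = x}
  zero_mem' := by simp
  add_mem' := by
    intro a b ha hb
    have : CharP F 2 := charP_of_injective_algebraMap (algebraMap (ZMod 2) F).injective 2
    have h := add_pow_char_pow (R := F) (p := 2) (n := 3) a b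
    simp only [Set.mem_ofPred_eq] at *
    norm_num at h
    rw [h, ha, hb]
  smul_mem' := by
    intro c x hx
    have hc : ∀ c : ZMod 2, c ^ 8 = c := by decide
    simp only [Set.mem_ofPred_eq] at *
    rw [smul_pow, hc, hx]

theorem mem_frobeniusCubeFixed {x : F} : x ∈ frobeniusCubeFixed F ↔ x ^ 8 = x := Iff.rfl

theorem cyclicShift_frobeniusCubeFixed {a : F} (ha : a ≠ 0) (h : a ∈ frobeniusCubeFixed F) :
    cyclicShift (ZMod 2) F a (frobeniusCubeFixed F) = frobeniusCubeFixed F := by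
  ext x
  simp only [mem_cyclicShift, mem_frobeniusCubeFixed] at *
  constructor
  · rintro ⟨v, hv, rfl⟩
    rw [mul_pow, h, hv]
  · intro hx
    exact ⟨a⁻¹ * x, by rw [mul_pow, inv_pow, h, hx], by field_simp⟩

variable [Fintype F]

/-- The nonzero vectors of a subspace, as a finset. -/
noncomputable def nonzeroVectors (U : Submodule (ZMod 2) F) : Finset F := by
  classical exact Finset.univ.filter fun x => x ∈ U ∧ x ≠ 0

theorem mem_nonzeroVectors {U : Submodule (ZMod 2) F} {x : F} :
    x ∈ nonzeroVectors U ↔ x ∈ U ∧ x ≠ 0 := by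
  simp [nonzeroVectors]

theorem card_nonzeroVectors_add_one (U : Submodule (ZMod 2) F) :
    (nonzeroVectors U).card + 1 = 2 ^ finrank (ZMod 2) U := by
  classical
  have h : insert 0 (nonzeroVectors U) = Finset.univ.filter fun x => x ∈ U := by
    ext x
    by_cases hx : x = 0 <;> simp [mem_nonzeroVectors, hx]
  rw [← Finset.card_insert_of_notMem (a := 0) (by simp [mem_nonzeroVectors]), h]
  have h2 := Module.natCard_eq_pow_finrank (K := ZMod 2) (V := U)
  rw [Nat.card_zmod] at h2
  rw [← h2, Nat.card_eq_fintype_card, Fintype.card_subtype]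

theorem six_le_subspaceDist_iff {U W : Submodule (ZMod 2) F}
    (hU : finrank (ZMod 2) U = 3) (hW : finrank (ZMod 2) W = 3) :
    6 ≤ subspaceDist (ZMod 2) F U W ↔ U ⊓ W = ⊥ := by
  rw [subspaceDist, hU, hW, ← Submodule.finrank_eq_zero (R := ZMod 2)]
  omega

/-- The nonzero vectors of the members of a partial spread of planes are counted without
repetition. -/
theorem card_biUnion_nonzeroVectors [DecidableEq F] {S : Finset (Submodule (ZMod 2) F)}
    (hdim : ∀ U ∈ S, finrank (ZMod 2) U = 3)
    (hdist : ∀ U ∈ S, ∀ W ∈ S, U ≠ W → 6 ≤ subspaceDist (ZMod 2) F U W) :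
    (S.biUnion nonzeroVectors).card = S.card * 7 := by
  rw [Finset.card_biUnion]
  · refine Finset.sum_const_nat fun U hU => ?_
    have h := card_nonzeroVectors_add_one U
    rw [hdim U hU] at h
    omega
  · intro U hU W hW hne
    have h := (six_le_subspaceDist_iff (hdim U hU) (hdim W hW)).1 (hdist U hU W hW hne)
    refine Finset.disjoint_left.2 fun x hx hx' => ?_
    rw [mem_nonzeroVectors] at hx hx'
    have : x ∈ U ⊓ W := ⟨hx.1, hx'.1⟩
    rw [h, Submodule.mem_bot] at this
    exact hx.2 this

theorem finrank_frobeniusCubeFixed (hF : Fintype.card F = 64) :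
    finrank (ZMod 2) (frobeniusCubeFixed F) = 3 := by
  classical
  have : Fact (Nat.Prime 7) := ⟨by norm_num⟩
  obtain ⟨u, hu⟩ := exists_prime_orderOf_dvd_card (G := Fˣ) 7
    (by rw [Fintype.card_units, hF]; norm_num)
  have hprim : IsPrimitiveRoot (u : F) 7 :=
    IsPrimitiveRoot.coe_units_iff.2 (hu ▸ IsPrimitiveRoot.orderOf u)
  have hset : nonzeroVectors (frobeniusCubeFixed F) = Polynomial.nthRootsFinset 7 (1 : F) := by
    ext x
    rw [mem_nonzeroVectors, Polynomial.mem_nthRootsFinset (by norm_num), mem_frobeniusCubeFixed]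
    constructor
    · rintro ⟨h, h0⟩
      exact mul_right_cancel₀ h0 (by rw [one_mul, ← pow_succ, h])
    · intro h
      refine ⟨by rw [pow_succ, h, one_mul], ?_⟩
      rintro rfl
      simp at h
  have h := card_nonzeroVectors_add_one (frobeniusCubeFixed F)
  rw [hset, hprim.card_nthRootsFinset] at h
  exact (Nat.pow_right_injective le_rfl (show 2 ^ 3 = 2 ^ _ from h)).symm

theorem isCyclicCode_orbitOf_frobeniusCubeFixed (hF : Fintype.card F = 64) :
    IsCyclicCode (ZMod 2) F 3 6 (orbitOf (ZMod 2) F (frobeniusCubeFixed F)) := by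
  have hK := finrank_frobeniusCubeFixed hF
  refine ⟨?_, ?_, ?_⟩
  · rintro U ⟨a, ha, rfl⟩
    rw [finrank_cyclicShift ha, hK]
  · rintro a ha U ⟨b, hb, rfl⟩
    exact ⟨a * b, mul_ne_zero ha hb, cyclicShift_cyclicShift a b _⟩
  · rintro U ⟨a, ha, rfl⟩ W ⟨b, hb, rfl⟩ hne
    rw [six_le_subspaceDist_iff (by rw [finrank_cyclicShift ha, hK])
      (by rw [finrank_cyclicShift hb, hK]), Submodule.eq_bot_iff]
    rintro x ⟨hxa, hxb⟩
    obtain ⟨v, hv, rfl⟩ := mem_cyclicShift.1 hxa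
    obtain ⟨w, hw, hvw⟩ := mem_cyclicShift.1 hxb
    by_contra hx
    have hv0 : v ≠ 0 := right_ne_zero_of_mul hx
    have hw0 : w ≠ 0 := right_ne_zero_of_mul (hvw ▸ hx)
    apply hne
    calc cyclicShift (ZMod 2) F a (frobeniusCubeFixed F)
        = cyclicShift (ZMod 2) F (a * v) (frobeniusCubeFixed F) := by
          rw [← cyclicShift_cyclicShift, cyclicShift_frobeniusCubeFixed hv0 hv]
      _ = cyclicShift (ZMod 2) F b (frobeniusCubeFixed F) := by
          rw [← hvw, ← cyclicShift_cyclicShift, cyclicShift_frobeniusCubeFixed hw0 hw]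

end

/-- 𝒞_2(6,6,3) = 9. -/
theorem C2_greatest :
    IsGreatest {m : ℕ | ∃ C : Set (Submodule (ZMod 2) (GaloisField 2 6)),
      IsCyclicCode (ZMod 2) (GaloisField 2 6) 3 6 C ∧ C.ncard = m} 9 := by
  classical
  have : Fintype (GaloisField 2 6) := Fintype.ofFinite _
  have hF : Fintype.card (GaloisField 2 6) = 64 := by
    rw [← Nat.card_eq_fintype_card, GaloisField.card 2 6 (by norm_num)]
    norm_num
  have hF0 : (Finset.univ.erase (0 : GaloisField 2 6)).card = 63 := by
    rw [Finset.card_erase_of_mem (Finset.mem_univ _), Finset.card_univ, hF]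
  have hcard : ∀ C : Set (Submodule (ZMod 2) (GaloisField 2 6)),
      IsCyclicCode (ZMod 2) (GaloisField 2 6) 3 6 C →
      (C.toFinite.toFinset.biUnion nonzeroVectors).card = C.ncard * 7 := by
    rintro C ⟨hdim, -, hdist⟩
    rw [Set.ncard_eq_toFinset_card C]
    exact card_biUnion_nonzeroVectors (by simpa using hdim) (by simpa using hdist)
  constructor
  · have hC := isCyclicCode_orbitOf_frobeniusCubeFixed hF
    refine ⟨_, hC, ?_⟩
    have h := hcard _ hC
    have hcover : (Set.toFinite (orbitOf (ZMod 2) (GaloisField 2 6)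
        (frobeniusCubeFixed (GaloisField 2 6)))).toFinset.biUnion nonzeroVectors =
        Finset.univ.erase 0 := by
      ext x
      simp only [Finset.mem_biUnion, mem_nonzeroVectors, Finset.mem_erase, Finset.mem_univ,
        and_true, Set.Finite.mem_toFinset]
      constructor
      · rintro ⟨U, -, -, hx⟩
        exact hx
      · intro hx
        exact ⟨_, ⟨x, hx, rfl⟩, mem_cyclicShift.2
          ⟨1, mem_frobeniusCubeFixed.2 (one_pow 8), mul_one x⟩, hx⟩
    rw [hcover, hF0] at h
    omega
  · rintro m ⟨C, hC, rfl⟩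
    have h := hcard C hC
    have hle : (C.toFinite.toFinset.biUnion nonzeroVectors).card ≤ 63 := by
      rw [← hF0]
      refine Finset.card_le_card fun x hx => ?_
      obtain ⟨U, -, hx⟩ := Finset.mem_biUnion.1 hx
      exact Finset.mem_erase.2 ⟨(mem_nonzeroVectors.1 hx).2, Finset.mem_univ x⟩
    omega
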